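/- arXiv:2410.04389 — 4 statements merged into one kernel-verified Lean document; each statement's English description precedes it below -/
import Mathlib

section
/- For every natural number n there exists a 2-edge-connected cubic graph G with more than n vertices such that for every perfect matching M of G there is no non-conflicting nowhere-zero Z2×Z2 flow with respect to M. -/
open scoped Classical

/-- The Klein four-group `Z2 × Z2`. -/
abbrev K4 : Type := ZMod 2 × ZMod 2

/-- `α = (1,0)`. -/
def flowAlpha : K4 := (1, 0)

/-- `β = (0,1)`. -/
def flowBeta : K4 := (0, 1)

/-- A graph is bridgeless if no edge is a bridge, i.e. deleting any single edge
does not increase the number of connected components. -/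
def SimpleGraph.Bridgeless {V : Type} (G : SimpleGraph V) : Prop :=
  ∀ e : Sym2 V, ¬ G.IsBridge e

/-- The complementary 2-factor `G − M`: the spanning subgraph of `G` with
edge set `E(G) \ M`. -/
def compl2Factor {V : Type} (G : SimpleGraph V) (M : G.Subgraph) : SimpleGraph V :=
  G.deleteEdges M.edgeSet

/-- A nowhere-zero `Z2 × Z2` flow with respect to a perfect matching `M`, encoded as a
vertex function: `θ v` is the flow value of the unique `M`-edge `e_v` incident to `v`
(so `θ` is constant on the two endpoints of each matching edge, nonzero everywhere,
and sums to zero over every connected component of `G − M`). -/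
def IsNZFlowWrt {V : Type} [Fintype V] (G : SimpleGraph V) (M : G.Subgraph)
    (θ : V → K4) : Prop :=
  (∀ ⦃u v : V⦄, M.Adj u v → θ u = θ v) ∧
  (∀ v : V, θ v ≠ 0) ∧
  (∀ u : V, ∑ v ∈ Finset.univ.filter (fun w => (compl2Factor G M).Reachable u w), θ v = 0)

/-- `θ` is non-conflicting: there is no edge `uv ∈ E(G) \ M` with
`θ(e_u) = α` and `θ(e_v) = β`. -/
def NonConflicting {V : Type} (G : SimpleGraph V) (M : G.Subgraph) (θ : V → K4) : Prop :=
  ¬ ∃ u v : V, G.Adj u v ∧ ¬ M.Adj u v ∧ θ u = flowAlpha ∧ θ v = flowBeta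

/-- Neighbours in the Petersen graph with the edge between `0` and `1` removed. -/
def petersenNbr : Fin 10 → List (Fin 10) :=
  ![[4, 5], [2, 6], [1, 3, 7], [2, 4, 8], [3, 0, 9], [0, 7, 8], [1, 9, 8], [2, 5, 9],
    [3, 6, 5], [4, 7, 6]]

lemma petersenNbr_symm : ∀ a b, a ∈ petersenNbr b → b ∈ petersenNbr a := by decide

lemma petersenNbr_ne : ∀ a b, a ∈ petersenNbr b → a ≠ b := by decide

/-- Every edge of the Petersen graph minus an edge lies on a five-cycle. -/
lemma petersenNbr_fiveCycle : ∀ a, ∀ b ∈ petersenNbr a, ∃ c ∈ petersenNbr a,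
    ∃ d ∈ petersenNbr c, ∃ e ∈ petersenNbr d, b ∈ petersenNbr e ∧ c ≠ b ∧ e ≠ a := by decide

/-- The map `f` embeds the Petersen graph minus the edge `01` into `G` as a piece whose only
outgoing edges join `f 0` to `p` and `f 1` to `q`. -/
structure IsPetersenPiece {W : Type} (G : SimpleGraph W) (f : Fin 10 → W) (p q : W) : Prop where
  inj : Function.Injective f
  ne_left : ∀ a, f a ≠ p
  ne_right : ∀ a, f a ≠ q
  adj_iff : ∀ a w, G.Adj (f a) w ↔
    (∃ b ∈ petersenNbr a, w = f b) ∨ (a = 0 ∧ w = p) ∨ (a = 1 ∧ w = q)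

set_option synthInstance.maxSize 1000 in
set_option synthInstance.maxHeartbeats 400000 in
/-- Five nonzero elements of the Klein four-group with zero sum contain a pair `{α, β}`. -/
lemma exists_conflict_of_sum_eq_zero (t : Fin 5 → K4) (h0 : ∀ i, t i ≠ 0) (hs : ∑ i, t i = 0)
    (h : ∀ i j, i ≠ j → ¬ (i = 0 ∧ j = 2) → ¬ (i = 2 ∧ j = 0) →
      ¬ (t i = flowAlpha ∧ t j = flowBeta)) :
    (t 0 = flowAlpha ∧ t 2 = flowBeta) ∨ (t 0 = flowBeta ∧ t 2 = flowAlpha) := by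
  have key : ∀ a b c d e : K4,
      a ≠ 0 ∧ b ≠ 0 ∧ c ≠ 0 ∧ d ≠ 0 ∧ e ≠ 0 ∧ a + b + c + d + e = 0 →
      (a = (1, 0) ∧ c = (0, 1)) ∨ (a = (0, 1) ∧ c = (1, 0)) ∨
      (((1, 0) = a ∨ (1, 0) = c) ∧ ((0, 1) = b ∨ (0, 1) = d ∨ (0, 1) = e)) ∨
      (((0, 1) = a ∨ (0, 1) = c) ∧ ((1, 0) = b ∨ (1, 0) = d ∨ (1, 0) = e)) ∨
      (((1, 0) = b ∨ (1, 0) = d ∨ (1, 0) = e) ∧ ((0, 1) = b ∨ (0, 1) = d ∨ (0, 1) = e)) := by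
    decide
  have hne : ((1, 0) : K4) ≠ (0, 1) := by decide
  have hk := key _ _ _ _ _ ⟨h0 0, h0 1, h0 2, h0 3, h0 4,
    by simpa [Fin.sum_univ_five] using hs⟩
  have h' : ∀ i j, i ≠ j → ¬ (i = 0 ∧ j = 2) → ¬ (i = 2 ∧ j = 0) →
      (1, 0) = t i → (0, 1) = t j → False :=
    fun i j h₁ h₂ h₃ h₄ h₅ => h i j h₁ h₂ h₃ ⟨h₄.symm, h₅.symm⟩
  rcases hk with hk | hk | hk | hk | hk
  · exact Or.inl hk
  · exact Or.inr hk
  · obtain ⟨hk₁ | hk₁, hk₂ | hk₂ | hk₂⟩ := hk <;>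
      exact (h' _ _ (by decide) (by decide) (by decide) hk₁ hk₂).elim
  · obtain ⟨hk₁ | hk₁, hk₂ | hk₂ | hk₂⟩ := hk <;>
      exact (h' _ _ (by decide) (by decide) (by decide) hk₂ hk₁).elim
  · obtain ⟨hk₁ | hk₁ | hk₁, hk₂ | hk₂ | hk₂⟩ := hk <;>
    first
      | exact (h' _ _ (by decide) (by decide) (by decide) hk₁ hk₂).elim
      | exact (hne (hk₁.trans hk₂.symm)).elim

/-- Distinct residues modulo five differ by `1` or `2` up to sign. -/
lemma forall_pair_of_forall_add {P : Fin 5 → Fin 5 → Prop} (h₁ : ∀ i, P i (i + 1))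
    (h_one' : ∀ i, P (i + 1) i) (h₂ : ∀ i, i ≠ 0 → P i (i + 2))
    (h_two' : ∀ i, i ≠ 0 → P (i + 2) i) :
    ∀ i j, i ≠ j → ¬ (i = 0 ∧ j = 2) → ¬ (i = 2 ∧ j = 0) → P i j := by
  intro i j h h' h''
  have key : ∀ i j : Fin 5, i ≠ j → ¬ (i = 0 ∧ j = 2) → ¬ (i = 2 ∧ j = 0) →
      j = i + 1 ∨ i = j + 1 ∨ (i ≠ 0 ∧ j = i + 2) ∨ (j ≠ 0 ∧ i = j + 2) := by decide
  rcases key i j h h' h'' with rfl | rfl | ⟨h0, rfl⟩ | ⟨h0, rfl⟩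
  exacts [h₁ _, h_one' _, h₂ _ h0, h_two' _ h0]

/-- The flow sums to zero along a five-cycle of the complementary 2-factor. -/
lemma sum_fiveCycle_eq_zero {W : Type} [Fintype W] {G : SimpleGraph W} {M : G.Subgraph}
    (hM : ∀ v, ∃! w, M.Adj v w) {θ : W → K4} (hθ : IsNZFlowWrt G M θ) (g m : Fin 5 → W)
    (hg : Function.Injective g) (hm : ∀ i, M.Adj (g i) (m i)) (hgm : ∀ i j, g j ≠ m i)
    (hadj : ∀ i w, G.Adj (g i) w ↔ w = g (i + 1) ∨ w = g (i - 1) ∨ w = m i) :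
    ∑ i, θ (g i) = 0 := by
  have hstep : ∀ i w, (compl2Factor G M).Adj (g i) w ↔ w = g (i + 1) ∨ w = g (i - 1) := by
    intro i w
    have hMi : M.Adj (g i) w ↔ w = m i :=
      ⟨fun h => (hM (g i)).unique h (hm i), fun h => h ▸ hm i⟩
    simp only [compl2Factor, SimpleGraph.deleteEdges_adj, SimpleGraph.Subgraph.mem_edgeSet, hMi,
      hadj]
    constructor
    · tauto
    · rintro (rfl | rfl) <;> simp [hgm]
  have hto : ∀ i, (compl2Factor G M).Reachable (g 0) (g i) := by
    intro i
    have hs : ∀ j, (compl2Factor G M).Reachable (g 0) (g j) →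
        (compl2Factor G M).Reachable (g 0) (g (j + 1)) := fun j hj =>
      hj.trans ((hstep j _).2 (Or.inl rfl)).reachable
    have h0 : (compl2Factor G M).Reachable (g 0) (g 0) := .refl _
    fin_cases i
    · exact h0
    · exact hs _ h0
    · exact hs _ (hs _ h0)
    · exact hs _ (hs _ (hs _ h0))
    · exact hs _ (hs _ (hs _ (hs _ h0)))
  have hfrom : ∀ u w, (compl2Factor G M).Reachable u w → u ∈ Set.range g → w ∈ Set.range g := by
    rintro u w ⟨p⟩
    induction p with
    | nil => exact id
    | cons h _ ih =>
      rintro ⟨i, rfl⟩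
      apply ih
      rcases (hstep i _).1 h with rfl | rfl <;> exact ⟨_, rfl⟩
  have hset : Finset.univ.filter (fun w => (compl2Factor G M).Reachable (g 0) w)
      = Finset.univ.image g := by
    ext w
    simp only [Finset.mem_filter, Finset.mem_univ, true_and, Finset.mem_image]
    exact ⟨fun h => hfrom _ _ h ⟨0, rfl⟩, by rintro ⟨i, rfl⟩; exact hto i⟩
  have := hθ.2.2 (g 0)
  rwa [hset, Finset.sum_image (fun _ _ _ _ h => hg h)] at this

namespace IsPetersenPiece

variable {W : Type} {G : SimpleGraph W} {f : Fin 10 → W} {p q : W} {M : G.Subgraph}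

/-- A perfect matching restricted to a piece is one of the six perfect matchings of the
Petersen graph. -/
lemma matching_cases (hf : IsPetersenPiece G f p q) (hM : ∀ v, ∃! w, M.Adj v w) :
    (¬ M.Adj (f 1) q ∧
      ((M.Adj (f 0) (f 5) ∧ M.Adj (f 1) (f 6) ∧ M.Adj (f 2) (f 7) ∧ M.Adj (f 3) (f 8) ∧
          M.Adj (f 4) (f 9)) ∨
        (M.Adj (f 0) (f 5) ∧ M.Adj (f 1) (f 2) ∧ M.Adj (f 3) (f 4) ∧ M.Adj (f 7) (f 9) ∧
          M.Adj (f 6) (f 8)) ∨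
        (M.Adj (f 1) (f 6) ∧ M.Adj (f 2) (f 3) ∧ M.Adj (f 0) (f 4) ∧ M.Adj (f 5) (f 8) ∧
          M.Adj (f 7) (f 9)) ∨
        (M.Adj (f 3) (f 8) ∧ M.Adj (f 0) (f 4) ∧ M.Adj (f 1) (f 2) ∧ M.Adj (f 5) (f 7) ∧
          M.Adj (f 6) (f 9)))) ∨
      (M.Adj (f 0) p ∧ M.Adj (f 1) q ∧
      ((M.Adj (f 2) (f 7) ∧ M.Adj (f 3) (f 4) ∧ M.Adj (f 6) (f 9) ∧ M.Adj (f 5) (f 8)) ∨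
        (M.Adj (f 4) (f 9) ∧ M.Adj (f 2) (f 3) ∧ M.Adj (f 6) (f 8) ∧ M.Adj (f 5) (f 7)))) := by
  have hex : ∀ a, (∃ b ∈ petersenNbr a, M.Adj (f a) (f b)) ∨ (a = 0 ∧ M.Adj (f 0) p) ∨
      (a = 1 ∧ M.Adj (f 1) q) := by
    intro a
    obtain ⟨w, hw, -⟩ := hM (f a)
    rcases (hf.adj_iff a w).1 hw.adj_sub with ⟨b, hb, rfl⟩ | ⟨rfl, rfl⟩ | ⟨rfl, rfl⟩
    · exact Or.inl ⟨b, hb, hw⟩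
    · exact Or.inr (Or.inl ⟨rfl, hw⟩)
    · exact Or.inr (Or.inr ⟨rfl, hw⟩)
  have huniq : ∀ a b c, b ≠ c → ¬ (M.Adj (f a) (f b) ∧ M.Adj (f a) (f c)) :=
    fun a b c hbc h => hbc (hf.inj ((hM (f a)).unique h.1 h.2))
  have hl : ∀ b, ¬ (M.Adj (f 0) p ∧ M.Adj (f 0) (f b)) := fun b h =>
    hf.ne_left b ((hM (f 0)).unique h.2 h.1)
  have hr : ∀ b, ¬ (M.Adj (f 1) q ∧ M.Adj (f 1) (f b)) := fun b h =>
    hf.ne_right b ((hM (f 1)).unique h.2 h.1)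
  have e0 := hex 0
  have e1 := hex 1
  have e2 := hex 2
  have e3 := hex 3
  have e4 := hex 4
  have e5 := hex 5
  have e6 := hex 6
  have e7 := hex 7
  have e8 := hex 8
  have e9 := hex 9
  have u0 := And.intro (huniq 0 4 5 (by decide)) (And.intro (hl 4) (hl 5))
  have u1 := And.intro (huniq 1 2 6 (by decide)) (And.intro (hr 2) (hr 6))
  have u2 := And.intro (huniq 2 1 3 (by decide))
    (And.intro (huniq 2 1 7 (by decide)) (huniq 2 3 7 (by decide)))
  have u3 := And.intro (huniq 3 2 4 (by decide))
    (And.intro (huniq 3 2 8 (by decide)) (huniq 3 4 8 (by decide)))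
  have u4 := And.intro (huniq 4 3 0 (by decide))
    (And.intro (huniq 4 3 9 (by decide)) (huniq 4 0 9 (by decide)))
  have u5 := And.intro (huniq 5 0 7 (by decide))
    (And.intro (huniq 5 0 8 (by decide)) (huniq 5 7 8 (by decide)))
  have u6 := And.intro (huniq 6 1 9 (by decide))
    (And.intro (huniq 6 1 8 (by decide)) (huniq 6 9 8 (by decide)))
  have u7 := And.intro (huniq 7 2 5 (by decide))
    (And.intro (huniq 7 2 9 (by decide)) (huniq 7 5 9 (by decide)))
  have u8 := And.intro (huniq 8 3 6 (by decide))
    (And.intro (huniq 8 3 5 (by decide)) (huniq 8 6 5 (by decide)))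
  have u9 := And.intro (huniq 9 4 7 (by decide))
    (And.intro (huniq 9 4 6 (by decide)) (huniq 9 7 6 (by decide)))
  simp only [petersenNbr, List.mem_cons, List.not_mem_nil, Matrix.cons_val, or_false,
    exists_eq_or_imp, exists_eq_left, Fin.reduceEq, false_and, true_and, false_or,
    zero_ne_one, one_ne_zero, Fin.isValue] at e0 e1 e2 e3 e4 e5 e6 e7 e8 e9
  clear hex huniq hl hr
  simp only [M.adj_comm (f 4) (f 0), M.adj_comm (f 5) (f 0), M.adj_comm (f 2) (f 1), M.adj_comm (f 6) (f 1),
    M.adj_comm (f 3) (f 2), M.adj_comm (f 7) (f 2), M.adj_comm (f 4) (f 3), M.adj_comm (f 8) (f 3),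
    M.adj_comm (f 9) (f 4), M.adj_comm (f 7) (f 5), M.adj_comm (f 8) (f 5), M.adj_comm (f 9) (f 6),
    M.adj_comm (f 8) (f 6), M.adj_comm (f 9) (f 7)]
    at e0 e1 e2 e3 e4 e5 e6 e7 e8 e9 u0 u1 u2 u3 u4 u5 u6 u7 u8 u9
  generalize M.Adj (f 0) (f 4) = x04 at *
  generalize M.Adj (f 0) (f 5) = x05 at *
  generalize M.Adj (f 1) (f 2) = x12 at *
  generalize M.Adj (f 1) (f 6) = x16 at *
  generalize M.Adj (f 2) (f 3) = x23 at *
  generalize M.Adj (f 2) (f 7) = x27 at *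
  generalize M.Adj (f 3) (f 4) = x34 at *
  generalize M.Adj (f 3) (f 8) = x38 at *
  generalize M.Adj (f 4) (f 9) = x49 at *
  generalize M.Adj (f 5) (f 7) = x57 at *
  generalize M.Adj (f 5) (f 8) = x58 at *
  generalize M.Adj (f 6) (f 9) = x69 at *
  generalize M.Adj (f 6) (f 8) = x68 at *
  generalize M.Adj (f 7) (f 9) = x79 at *
  generalize M.Adj (f 0) p = x0 at *
  generalize M.Adj (f 1) q = x1 at *
  clear hM hf
  grind (splits := 30)

variable [Fintype W] {θ : W → K4}

lemma conflict_of_not_mem (hf : IsPetersenPiece G f p q) (hM : ∀ v, ∃! w, M.Adj v w)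
    (hθ : IsNZFlowWrt G M θ) (hc : NonConflicting G M θ) (c d : Fin 5 → Fin 10)
    (hinj : Function.Injective c) (hcd : ∀ i j, c j ≠ d i)
    (hnbr : ∀ i b, b ∈ petersenNbr (c i) ↔ b = c (i + 1) ∨ b = c (i - 1) ∨ b = d i)
    (hd : ∀ i, i ≠ 0 → d (i + 2) ∈ petersenNbr (d i)) (hd0 : d 0 = 0) (hd2 : d 2 = 1)
    (hm : ∀ i, M.Adj (f (c i)) (f (d i))) :
    (θ (f 0) = flowAlpha ∧ θ (f 1) = flowBeta) ∨
      (θ (f 0) = flowBeta ∧ θ (f 1) = flowAlpha) := by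
  have hpart : ∀ i w, M.Adj (f (c i)) w ↔ w = f (d i) := fun i w =>
    ⟨fun h => (hM _).unique h (hm i), fun h => h ▸ hm i⟩
  have hpart' : ∀ i w, M.Adj (f (d i)) w ↔ w = f (c i) := fun i w =>
    ⟨fun h => (hM _).unique h (hm i).symm, fun h => h ▸ (hm i).symm⟩
  have hc0 : ∀ i, c i ≠ 0 := fun i => hd0 ▸ hcd 0 i
  have hc1 : ∀ i, c i ≠ 1 := fun i => hd2 ▸ hcd 2 i
  have hadj : ∀ i w, G.Adj (f (c i)) w ↔
      w = f (c (i + 1)) ∨ w = f (c (i - 1)) ∨ w = f (d i) := by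
    intro i w
    simp [hf.adj_iff, hnbr, hc0, hc1]
  have hs := sum_fiveCycle_eq_zero hM hθ (fun i => f (c i)) (fun i => f (d i))
    (hf.inj.comp hinj) hm (fun i j h => hcd i j (hf.inj h)) hadj
  have hcc : ∀ i, ¬ (θ (f (c i)) = flowAlpha ∧ θ (f (c (i + 1))) = flowBeta) := fun i h =>
    hc ⟨_, _, (hadj i _).2 (Or.inl rfl),
      fun h' => hcd _ _ (hf.inj ((hpart _ _).1 h')), h.1, h.2⟩
  have hcc' : ∀ i, ¬ (θ (f (c (i + 1))) = flowAlpha ∧ θ (f (c i)) = flowBeta) := fun i h =>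
    hc ⟨_, _, ((hadj i _).2 (Or.inl rfl)).symm,
      fun h' => hcd _ _ (hf.inj ((hpart _ _).1 h')), h.1, h.2⟩
  have hdG : ∀ i, i ≠ 0 → G.Adj (f (d i)) (f (d (i + 2))) := fun i hi =>
    (hf.adj_iff _ _).2 (Or.inl ⟨_, hd i hi, rfl⟩)
  have hdd : ∀ i, i ≠ 0 → ¬ (θ (f (d i)) = flowAlpha ∧ θ (f (d (i + 2))) = flowBeta) :=
    fun i hi h => hc ⟨_, _, hdG i hi,
      fun h' => hcd _ _ (hf.inj ((hpart' _ _).1 h')).symm, h.1, h.2⟩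
  have hdd' : ∀ i, i ≠ 0 → ¬ (θ (f (d (i + 2))) = flowAlpha ∧ θ (f (d i)) = flowBeta) :=
    fun i hi h => hc ⟨_, _, (hdG i hi).symm,
      fun h' => hcd _ _ (hf.inj ((hpart' _ _).1 h')).symm, h.1, h.2⟩
  have ht : ∀ i, θ (f (d i)) = θ (f (c i)) := fun i => (hθ.1 (hm i)).symm
  simp only [ht] at hdd hdd'
  rw [← hd0, ← hd2, ht, ht]
  exact exists_conflict_of_sum_eq_zero (fun i => θ (f (c i))) (fun i => hθ.2.1 _) hs
    (forall_pair_of_forall_add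
      (P := fun i j => ¬ (θ (f (c i)) = flowAlpha ∧ θ (f (c j)) = flowBeta)) hcc hcc' hdd hdd')

lemma not_mem_of_nonConflicting (hf : IsPetersenPiece G f p q) (hM : ∀ v, ∃! w, M.Adj v w)
    (hθ : IsNZFlowWrt G M θ) (hc : NonConflicting G M θ) (c d : Fin 5 → Fin 10)
    (hc' : Function.Injective c) (hd' : Function.Injective d) (hcd : ∀ i j, c j ≠ d i)
    (hc0 : c 0 = 0) (hd0 : d 0 = 1)
    (hcn : ∀ i b, b ∈ petersenNbr (c i) ↔
      b = c (i + 1) ∨ b = c (i - 1) ∨ (i ≠ 0 ∧ b = d i))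
    (hdn : ∀ i b, b ∈ petersenNbr (d i) ↔
      b = d (i + 2) ∨ b = d (i - 2) ∨ (i ≠ 0 ∧ b = c i))
    (hm : ∀ i, i ≠ 0 → M.Adj (f (c i)) (f (d i)))
    (hp : M.Adj (f 0) p) (hq : M.Adj (f 1) q) : False := by
  have hc1 : ∀ i, c i ≠ 1 := fun i => hd0 ▸ hcd 0 i
  have hd1 : ∀ i, d i ≠ 0 := fun i => hc0 ▸ (hcd i 0).symm
  have hci : ∀ i, c i = 0 ↔ i = 0 := fun i => by rw [← hc0, hc'.eq_iff]
  have hdi : ∀ i, d i = 1 ↔ i = 0 := fun i => by rw [← hd0, hd'.eq_iff]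
  set m : Fin 5 → W := fun i => if i = 0 then p else f (d i) with hmdef
  set m' : Fin 5 → W := fun i => if i = 0 then q else f (c i) with hmdef'
  have hmM : ∀ i, M.Adj (f (c i)) (m i) := by
    intro i
    by_cases hi : i = 0
    · subst hi; simpa [hmdef, hc0] using hp
    · simpa [hmdef, hi] using hm i hi
  have hmM' : ∀ i, M.Adj (f (d i)) (m' i) := by
    intro i
    by_cases hi : i = 0
    · subst hi; simpa [hmdef', hd0] using hq
    · simpa [hmdef', hi] using (hm i hi).symm
  have hne : ∀ i j, f (c j) ≠ m i := by
    intro i j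
    by_cases hi : i = 0
    · simpa [hmdef, hi] using hf.ne_left _
    · simpa [hmdef, hi] using hf.inj.ne (hcd i j)
  have hne' : ∀ i j, f (d j) ≠ m' i := by
    intro i j
    by_cases hi : i = 0
    · simpa [hmdef', hi] using hf.ne_right _
    · simpa [hmdef', hi] using hf.inj.ne (hcd j i).symm
  have hadj : ∀ i w, G.Adj (f (c i)) w ↔
      w = f (c (i + 1)) ∨ w = f (c (i - 1)) ∨ w = m i := by
    intro i w
    by_cases hi : i = 0
    · simp [hf.adj_iff, hcn, hc1, hci, hi, hmdef, or_assoc]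
    · simp [hf.adj_iff, hcn, hc1, hci, hi, hmdef]
  have hadj' : ∀ i w, G.Adj (f (d i)) w ↔
      w = f (d (i + 2)) ∨ w = f (d (i - 2)) ∨ w = m' i := by
    intro i w
    by_cases hi : i = 0
    · simp [hf.adj_iff, hdn, hd1, hdi, hi, hmdef', or_assoc]
    · simp [hf.adj_iff, hdn, hd1, hdi, hi, hmdef']
  have hs := sum_fiveCycle_eq_zero hM hθ (fun i => f (c i)) m (hf.inj.comp hc') hmM hne hadj
  have hs' := sum_fiveCycle_eq_zero hM hθ (fun i => f (d (2 * i))) (fun i => m' (2 * i))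
    (hf.inj.comp (hd'.comp (by decide : Function.Injective fun i : Fin 5 => 2 * i)))
    (fun i => hmM' _) (fun i j => hne' _ _) (fun i w => by
      
      rw [hadj', (by decide : ∀ i : Fin 5, 2 * (i + 1) = 2 * i + 2),
        (by decide : ∀ i : Fin 5, 2 * (i - 1) = 2 * i - 2)])
  have ht : ∀ i, i ≠ 0 → θ (f (d i)) = θ (f (c i)) := fun i hi => (hθ.1 (hm i hi)).symm
  have ht0 : θ (f (d 0)) = θ (f (c 0)) := by
    have e1 := ht 1 (by decide)
    have e2 := ht 2 (by decide)
    have e3 := ht 3 (by decide)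
    have e4 := ht 4 (by decide)
    simp only [Fin.sum_univ_five] at hs hs'
    change θ (f (d 0)) + θ (f (d 2)) + θ (f (d 4)) + θ (f (d 1)) + θ (f (d 3)) = 0 at hs'
    rw [e1, e2, e3, e4] at hs'
    rw [← sub_eq_zero, ← sub_zero (0 : K4)]
    nth_rewrite 1 [← hs']
    rw [← hs]
    abel
  have ht' : ∀ i, θ (f (d i)) = θ (f (c i)) := fun i => by
    by_cases hi : i = 0
    · rw [hi, ht0]
    · exact ht i hi
  have hcc : ∀ i, ¬ (θ (f (c i)) = flowAlpha ∧ θ (f (c (i + 1))) = flowBeta) := fun i h =>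
    hc ⟨_, _, (hadj i _).2 (Or.inl rfl),
      fun h' => hne _ _ ((hM _).unique h' (hmM i)), h.1, h.2⟩
  have hcc' : ∀ i, ¬ (θ (f (c (i + 1))) = flowAlpha ∧ θ (f (c i)) = flowBeta) := fun i h =>
    hc ⟨_, _, ((hadj i _).2 (Or.inl rfl)).symm,
      fun h' => hne _ _ ((hM _).unique h' (hmM (i + 1))), h.1, h.2⟩
  have hdd : ∀ i, ¬ (θ (f (d i)) = flowAlpha ∧ θ (f (d (i + 2))) = flowBeta) := fun i h =>
    hc ⟨_, _, (hadj' i _).2 (Or.inl rfl),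
      fun h' => hne' _ _ ((hM _).unique h' (hmM' i)), h.1, h.2⟩
  have hdd' : ∀ i, ¬ (θ (f (d (i + 2))) = flowAlpha ∧ θ (f (d i)) = flowBeta) := fun i h =>
    hc ⟨_, _, ((hadj' i _).2 (Or.inl rfl)).symm,
      fun h' => hne' _ _ ((hM _).unique h' (hmM' (i + 2))), h.1, h.2⟩
  simp only [ht'] at hdd hdd'
  rcases exists_conflict_of_sum_eq_zero (fun i => θ (f (c i))) (fun i => hθ.2.1 _) hs
    (forall_pair_of_forall_add
      (P := fun i j => ¬ (θ (f (c i)) = flowAlpha ∧ θ (f (c j)) = flowBeta)) hcc hcc'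
      (fun i _ => hdd i) (fun i _ => hdd' i)) with h | h
  · exact hdd 0 h
  · exact hdd' 0 h.symm

theorem conflict (hf : IsPetersenPiece G f p q) (hM : ∀ v, ∃! w, M.Adj v w)
    (hθ : IsNZFlowWrt G M θ) (hc : NonConflicting G M θ) :
    ¬ M.Adj (f 1) q ∧ ((θ (f 0) = flowAlpha ∧ θ (f 1) = flowBeta) ∨
      (θ (f 0) = flowBeta ∧ θ (f 1) = flowAlpha)) := by
  rcases hf.matching_cases hM with ⟨hq, h⟩ | ⟨hp, hq, h⟩
  · refine ⟨hq, ?_⟩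
    rcases h with h | h | h | h
    · exact hf.conflict_of_not_mem hM hθ hc ![5, 8, 6, 9, 7] ![0, 3, 1, 4, 2] (by decide)
        (by decide) (by decide) (by decide) rfl rfl
        (by simp [Fin.forall_fin_succ, h, M.adj_comm (f 5), M.adj_comm (f 8), M.adj_comm (f 6),
          M.adj_comm (f 9), M.adj_comm (f 7)])
    · exact hf.conflict_of_not_mem hM hθ hc ![5, 7, 2, 3, 8] ![0, 9, 1, 4, 6] (by decide)
        (by decide) (by decide) (by decide) rfl rfl
        (by simp [Fin.forall_fin_succ, h, M.adj_comm (f 5), M.adj_comm (f 2), M.adj_comm (f 8)])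
    · exact hf.conflict_of_not_mem hM hθ hc ![4, 9, 6, 8, 3] ![0, 7, 1, 5, 2] (by decide)
        (by decide) (by decide) (by decide) rfl rfl
        (by simp [Fin.forall_fin_succ, h, M.adj_comm (f 4), M.adj_comm (f 9), M.adj_comm (f 6),
          M.adj_comm (f 8), M.adj_comm (f 3)])
    · exact hf.conflict_of_not_mem hM hθ hc ![4, 3, 2, 7, 9] ![0, 8, 1, 5, 6] (by decide)
        (by decide) (by decide) (by decide) rfl rfl
        (by simp [Fin.forall_fin_succ, h, M.adj_comm (f 4), M.adj_comm (f 2), M.adj_comm (f 7),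
          M.adj_comm (f 9)])
  · exfalso
    rcases h with h | h
    · exact hf.not_mem_of_nonConflicting hM hθ hc ![0, 4, 9, 7, 5] ![1, 3, 6, 2, 8] (by decide)
        (by decide) (by decide) rfl rfl (by decide) (by decide)
        (by simp [Fin.forall_fin_succ, h, M.adj_comm (f 4), M.adj_comm (f 9), M.adj_comm (f 7)])
        hp hq
    · exact hf.not_mem_of_nonConflicting hM hθ hc ![0, 4, 3, 8, 5] ![1, 9, 2, 6, 7] (by decide)
        (by decide) (by decide) rfl rfl (by decide) (by decide)
        (by simp [Fin.forall_fin_succ, h, M.adj_comm (f 3), M.adj_comm (f 8)])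
        hp hq

end IsPetersenPiece

theorem IsPetersenPiece.degree_eq {W : Type} [Fintype W] {G : SimpleGraph W} {f : Fin 10 → W}
    {p q : W} (hf : IsPetersenPiece G f p q) (a : Fin 10) : G.degree (f a) = 3 := by
  have key : ∀ x y z, x ≠ y → x ≠ z → y ≠ z →
      (∀ w, G.Adj (f a) w ↔ w = x ∨ w = y ∨ w = z) → G.degree (f a) = 3 := by
    intro x y z hxy hxz hyz h
    rw [← SimpleGraph.card_neighborFinset_eq_degree, Finset.card_eq_three]
    exact ⟨x, y, z, hxy, hxz, hyz, by ext w; simp [h]⟩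
  have hout : ∀ b c, b ≠ c → f b ≠ f c := fun b c => hf.inj.ne
  have key' : ∀ b c d, b ≠ c ∧ b ≠ d ∧ c ≠ d →
      (∀ w, G.Adj (f a) w ↔ w = f b ∨ w = f c ∨ w = f d) → G.degree (f a) = 3 := fun b c d h =>
    key _ _ _ (hout _ _ h.1) (hout _ _ h.2.1) (hout _ _ h.2.2)
  have hadj := hf.adj_iff a
  fin_cases a
  · exact key (f 4) (f 5) p (hout _ _ (by decide)) (hf.ne_left _) (hf.ne_left _)
      (by simpa [petersenNbr, or_assoc] using hadj)
  · exact key (f 2) (f 6) q (hout _ _ (by decide)) (hf.ne_right _) (hf.ne_right _)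
      (by simpa [petersenNbr, or_assoc] using hadj)
  · exact key' 1 3 7 (by decide) (by simpa [petersenNbr] using hadj)
  · exact key' 2 4 8 (by decide) (by simpa [petersenNbr] using hadj)
  · exact key' 3 0 9 (by decide) (by simpa [petersenNbr] using hadj)
  · exact key' 0 7 8 (by decide) (by simpa [petersenNbr] using hadj)
  · exact key' 1 9 8 (by decide) (by simpa [petersenNbr] using hadj)
  · exact key' 2 5 9 (by decide) (by simpa [petersenNbr] using hadj)
  · exact key' 3 6 5 (by decide) (by simpa [petersenNbr] using hadj)
  · exact key' 4 7 6 (by decide) (by simpa [petersenNbr] using hadj)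

/-- A necklace of `k` copies of the Petersen graph minus an edge. -/
def petersenNecklace (k : ℕ) : SimpleGraph (ZMod k × Fin 10) where
  Adj x y := (x.1 = y.1 ∧ y.2 ∈ petersenNbr x.2) ∨ (x.2 = 0 ∧ y = (x.1 - 1, 1)) ∨
    (x.2 = 1 ∧ y = (x.1 + 1, 0))
  symm := ⟨by
    rintro ⟨i, a⟩ ⟨j, b⟩ (⟨h, h'⟩ | ⟨h, h'⟩ | ⟨h, h'⟩)
    · exact Or.inl ⟨h.symm, petersenNbr_symm _ _ h'⟩
    · simp only [Prod.mk.injEq] at h h'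
      simp [h, h']
    · simp only [Prod.mk.injEq] at h h'
      simp [h, h']⟩
  loopless := ⟨by
    rintro ⟨i, a⟩ (⟨-, h⟩ | ⟨h, h'⟩ | ⟨h, h'⟩)
    · exact petersenNbr_ne _ _ h rfl
    · simp only [Prod.mk.injEq] at h h'
      simp [h] at h'
    · simp only [Prod.mk.injEq] at h h'
      simp [h] at h'⟩

namespace petersenNecklace

variable {k : ℕ}

lemma adj_inner (i : ZMod k) {a b : Fin 10} (h : b ∈ petersenNbr a) :
    (petersenNecklace k).Adj (i, a) (i, b) := Or.inl ⟨rfl, h⟩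

lemma adj_link (i : ZMod k) : (petersenNecklace k).Adj (i, 1) (i + 1, 0) :=
  Or.inr (Or.inr ⟨rfl, rfl⟩)

lemma isPetersenPiece [Fact (1 < k)] {W : Type} {G : SimpleGraph W}
    (φ : petersenNecklace k ≃g G) (i : ZMod k) :
    IsPetersenPiece G (fun a => φ (i, a)) (φ (i - 1, 1)) (φ (i + 1, 0)) where
  inj := φ.injective.comp (Prod.mk_right_injective i)
  ne_left a h := by simpa using (congrArg Prod.fst (φ.injective h)).symm
  ne_right a h := by simpa using congrArg Prod.fst (φ.injective h)
  adj_iff a w := by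
    obtain ⟨⟨j, b⟩, rfl⟩ := φ.surjective w
    simp only [φ.map_adj_iff, φ.injective.eq_iff, Prod.mk.injEq]
    simp only [petersenNecklace, Prod.mk.injEq]
    constructor
    · rintro (⟨rfl, h⟩ | h | h)
      · exact Or.inl ⟨b, h, rfl, rfl⟩
      · exact Or.inr (Or.inl h)
      · exact Or.inr (Or.inr h)
    · rintro (⟨c, h, rfl, rfl⟩ | h | h)
      · exact Or.inl ⟨rfl, h⟩
      · exact Or.inr (Or.inl h)
      · exact Or.inr (Or.inr h)

lemma reachable_zero {W : Type} {H : SimpleGraph W} {f : Fin 10 → W}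
    (h : ∀ a, ∀ b ∈ petersenNbr a, H.Adj (f a) (f b)) (a : Fin 10) :
    H.Reachable (f a) (f 0) := by
  have hs : ∀ a b, b ∈ petersenNbr a → H.Reachable (f b) (f 0) → H.Reachable (f a) (f 0) :=
    fun a b hb hr => (h a b hb).reachable.trans hr
  have r4 := hs 4 0 (by decide) (.refl _)
  have r5 := hs 5 0 (by decide) (.refl _)
  have r3 := hs 3 4 (by decide) r4
  have r9 := hs 9 4 (by decide) r4
  have r7 := hs 7 5 (by decide) r5
  have r8 := hs 8 5 (by decide) r5
  have r2 := hs 2 3 (by decide) r3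
  have r6 := hs 6 9 (by decide) r9
  have r1 := hs 1 2 (by decide) r2
  fin_cases a
  exacts [.refl _, r1, r2, r3, r4, r5, r6, r7, r8, r9]

theorem connected [NeZero k] : (petersenNecklace k).Connected := by
  have hin : ∀ (i : ZMod k) a, (petersenNecklace k).Reachable (i, a) (i, 0) := fun i =>
    reachable_zero (f := fun a => (i, a)) fun a b hb => adj_inner i hb
  have hlink : ∀ j : ℕ, (petersenNecklace k).Reachable ((j : ZMod k), 0) (0, 0) := by
    intro j
    induction j with
    | zero => simp
    | succ j ih =>
      push_cast
      exact (adj_link _).symm.reachable.trans ((hin _ 1).trans ih)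
  have h0 : ∀ x, (petersenNecklace k).Reachable x (0, 0) := by
    rintro ⟨i, a⟩
    refine (hin i a).trans ?_
    simpa using hlink i.val
  exact ⟨fun x y => (h0 x).trans (h0 y).symm⟩

lemma reachable_delete_link [NeZero k] (i : ZMod k) :
    ((petersenNecklace k).deleteEdges {s((i, 1), (i + 1, 0))}).Reachable (i + 1, 0) (i, 1) := by
  set H := (petersenNecklace k).deleteEdges {s((i, 1), (i + 1, 0))} with hH
  have hin : ∀ (j : ZMod k) a, H.Reachable (j, a) (j, 0) := fun j =>
    reachable_zero (f := fun a => (j, a)) fun a b hb => by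
      have hab : ¬ (a = 1 ∧ b = 0) ∧ ¬ (a = 0 ∧ b = 1) := by revert a b; decide
      simp only [hH, SimpleGraph.deleteEdges_adj, Set.mem_singleton_iff, Sym2.eq_iff,
        Prod.mk.injEq]
      refine ⟨adj_inner j hb, ?_⟩
      tauto
  have hlink : ∀ j : ℕ, j < k → H.Reachable (i + 1, 0) (i + 1 + j, 0) := by
    intro j
    induction j with
    | zero => simp
    | succ j ih =>
      intro hj
      have hne : i + 1 + (j : ZMod k) ≠ i := by
        intro h
        have h' : ((j + 1 : ℕ) : ZMod k) = 0 := by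
          push_cast
          linear_combination h
        rw [ZMod.natCast_eq_zero_iff] at h'
        exact absurd (Nat.le_of_dvd j.succ_pos h') (by omega)
      have hadj : H.Adj (i + 1 + j, 1) (i + 1 + j + 1, 0) := by
        simp [hH, SimpleGraph.deleteEdges_adj, adj_link, hne]
      have := (ih (by omega)).trans ((hin _ 1).symm.trans hadj.reachable)
      rwa [Nat.cast_succ, ← add_assoc]
  have hk := NeZero.pos k
  have h := hlink (k - 1) (by omega)
  rw [Nat.cast_sub hk] at h
  have hi : i + 1 + ((k : ZMod k) - (1 : ℕ)) = i := by simp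
  rw [hi] at h
  exact h.trans (hin i 1).symm

theorem reachable_delete_of_adj [NeZero k] {x y : ZMod k × Fin 10}
    (h : (petersenNecklace k).Adj x y) :
    ((petersenNecklace k).deleteEdges {s(x, y)}).Reachable x y := by
  obtain ⟨i, a⟩ := x
  obtain ⟨j, b⟩ := y
  rcases h with ⟨h, hb⟩ | ⟨h, h'⟩ | ⟨h, h'⟩
  · obtain rfl : i = j := h
    obtain ⟨c, hc, d, hd, e, he, hbe, hcb, hea⟩ := petersenNbr_fiveCycle a b hb
    have hca := petersenNbr_ne _ _ hc
    have heb := petersenNbr_ne _ _ hbe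
    have step : ∀ u v, v ∈ petersenNbr u → ¬ (u = a ∧ v = b) → ¬ (u = b ∧ v = a) →
        ((petersenNecklace k).deleteEdges {s((i, a), (i, b))}).Reachable (i, u) (i, v) := by
      intro u v huv h₁ h₂
      refine SimpleGraph.Adj.reachable ?_
      rw [SimpleGraph.deleteEdges_adj]
      refine ⟨adj_inner i huv, ?_⟩
      simp only [Set.mem_singleton_iff, Sym2.eq_iff, Prod.mk.injEq]
      tauto
    exact (step a c hc (by tauto) (by tauto)).trans ((step c d hd (by tauto) (by tauto)).trans
      ((step d e he (by tauto) (by tauto)).trans (step e b hbe (by tauto) (by tauto))))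
  · obtain rfl : a = 0 := h
    rw [h']
    have := reachable_delete_link (i - 1)
    rwa [sub_add_cancel, Sym2.eq_swap] at this
  · obtain rfl : a = 1 := h
    rw [h']
    exact (reachable_delete_link i).symm

theorem bridgeless [NeZero k] {W : Type} {G : SimpleGraph W} (φ : petersenNecklace k ≃g G) :
    G.Bridgeless := by
  intro e he
  induction e with | h u v
  obtain ⟨x, rfl⟩ := φ.surjective u
  obtain ⟨y, rfl⟩ := φ.surjective v
  have hG : G.Connected := φ.connected_iff.1 connected
  have hxy := φ.map_adj_iff.1 (he.reachable_iff_adj.1 (hG.preconnected (φ x) (φ y)))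
  refine he ((reachable_delete_of_adj hxy).map ⟨φ, fun {a b} hab => ?_⟩)
  rw [SimpleGraph.deleteEdges_adj] at hab ⊢
  refine ⟨φ.map_adj_iff.2 hab.1, fun h => hab.2 ?_⟩
  simpa [Sym2.eq_iff] using h

theorem not_exists_flow [Fact (1 < k)] (hk : Odd k) {W : Type} [Fintype W] {G : SimpleGraph W}
    (φ : petersenNecklace k ≃g G) {M : G.Subgraph} (hM : M.IsPerfectMatching) :
    ¬ ∃ θ : W → K4, IsNZFlowWrt G M θ ∧ NonConflicting G M θ := by
  rintro ⟨θ, hθ, hc⟩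
  have : NeZero k := ⟨by have := Fact.out (p := 1 < k); omega⟩
  have hpiece := fun i => (isPetersenPiece φ i).conflict
    (SimpleGraph.Subgraph.isPerfectMatching_iff.1 hM) hθ hc
  have hαβ : flowAlpha ≠ flowBeta := by simp [flowAlpha, flowBeta]
  set s : ZMod k → ZMod 2 := fun i => if θ (φ (i, 0)) = flowAlpha then 1 else 0 with hs
  have hstep : ∀ i, s (i + 1) = s i + 1 := by
    intro i
    have hadj : G.Adj (φ (i, 1)) (φ (i + 1, 0)) := φ.map_adj_iff.2 (adj_link i)
    obtain ⟨hMi, hi⟩ := hpiece i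
    have hi' := (hpiece (i + 1)).2
    have h₁ : ¬ (θ (φ (i, 1)) = flowAlpha ∧ θ (φ (i + 1, 0)) = flowBeta) := fun h =>
      hc ⟨_, _, hadj, hMi, h⟩
    have h₂ : ¬ (θ (φ (i + 1, 0)) = flowAlpha ∧ θ (φ (i, 1)) = flowBeta) := fun h =>
      hc ⟨_, _, hadj.symm, fun h' => hMi h'.symm, h⟩
    rcases hi with hi | hi <;> rcases hi' with hi' | hi' <;>
      simp_all [hαβ.symm, show (1 : ZMod 2) + 1 = 0 from rfl]
  have hsum : ∑ i, s (i + 1) = ∑ i, s i := Equiv.sum_comp (Equiv.addRight (1 : ZMod k)) s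
  simp only [hstep, Finset.sum_add_distrib, Finset.sum_const, Finset.card_univ, ZMod.card,
    nsmul_eq_mul, mul_one, add_eq_left] at hsum
  rw [ZMod.natCast_eq_zero_iff_even] at hsum
  exact Nat.not_even_iff_odd.2 hk hsum

end petersenNecklace

/-- For every natural number `n` there exists a 2-edge-connected cubic graph with more
than `n` vertices such that for every perfect matching `M` there is no non-conflicting
nowhere-zero `Z2 × Z2` flow with respect to `M`. -/
theorem stmt_15 (n : ℕ) :
    ∃ (m : ℕ) (G : SimpleGraph (Fin m)),
      n < m ∧ G.Connected ∧ 2 ≤ m ∧ G.Bridgeless ∧ G.IsRegularOfDegree 3 ∧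
      ∀ M : G.Subgraph, M.IsPerfectMatching →
        ¬ ∃ θ : Fin m → K4, IsNZFlowWrt G M θ ∧ NonConflicting G M θ := by
  have : Fact (1 < 2 * n + 3) := ⟨by omega⟩
  let e : Fin ((2 * n + 3) * 10) ≃ ZMod (2 * n + 3) × Fin 10 :=
    (Fintype.equivFinOfCardEq (by simp [ZMod.card])).symm
  let φ := (SimpleGraph.Iso.comap e (petersenNecklace (2 * n + 3))).symm
  refine ⟨_, (petersenNecklace (2 * n + 3)).comap e, by omega,
    φ.connected_iff.1 petersenNecklace.connected, by omega, petersenNecklace.bridgeless φ, ?_,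
    fun M hM => petersenNecklace.not_exists_flow ⟨n + 1, by ring⟩ φ hM⟩
  intro v
  obtain ⟨⟨i, a⟩, rfl⟩ := φ.surjective v
  exact (petersenNecklace.isPetersenPiece φ i).degree_eq a
end

section
/- Let G be a cubic graph and M a perfect matching of G such that G − M has exactly two connected components C1 and C2, both cycles of odd length. Suppose e = uv and f = u'v' are two distinct edges of M with u, u' ∈ V(C1) and v, v' ∈ V(C2), such that u and u' are not adjacent in G and v and v' are not adjacent in G. Then the function θ on M defined by θ(e) = α, θ(f) = β, and θ(g) = α+β for every other edge g ∈ M is a non-conflicting nowhere-zero Z2×Z2 flow with respect to M. -/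
open scoped Classical

/-- On a finite set with an odd number of elements, the function taking the value `α` at `a`,
`β` at `b` and `α + β` elsewhere sums to zero. -/
theorem sum_eq_zero_of_odd_card {V : Type} (S : Finset V) (hS : Odd S.card) {a b : V}
    (ha : a ∈ S) (hb : b ∈ S) (hab : a ≠ b) (θ : V → K4) (hθa : θ a = flowAlpha)
    (hθb : θ b = flowBeta) (hθ : ∀ w ∈ S, w ≠ a → w ≠ b → θ w = flowAlpha + flowBeta) :
    ∑ w ∈ S, θ w = 0 := by
  have key : ∀ w ∈ S, θ w = (flowAlpha + flowBeta) +
      ((if w = a then flowBeta else 0) + (if w = b then flowAlpha else 0)) := by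
    intro w hw
    by_cases h1 : w = a
    · subst h1
      rw [if_pos rfl, if_neg hab, hθa]
      decide
    · by_cases h2 : w = b
      · subst h2
        rw [if_neg h1, if_pos rfl, hθb]
        decide
      · rw [if_neg h1, if_neg h2, hθ w hw h1 h2, add_zero, add_zero]
  obtain ⟨k, hk⟩ := hS
  have hodd : S.card • (flowAlpha + flowBeta) = flowAlpha + flowBeta := by
    have h2 : 2 • (flowAlpha + flowBeta) = 0 := by decide
    rw [hk, add_nsmul, mul_comm, mul_nsmul', h2, nsmul_zero, zero_add, one_nsmul]
  rw [Finset.sum_congr rfl key, Finset.sum_add_distrib, Finset.sum_const,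
    Finset.sum_add_distrib, Finset.sum_ite_eq', Finset.sum_ite_eq', if_pos ha, if_pos hb, hodd]
  decide

/-- Suppose `G − M` has exactly two connected components `C1` (the component of `u`) and
`C2` (the component of `v`), both odd cycles, `e = uv` and `f = u'v'` are distinct edges
of `M` with `u, u' ∈ C1`, `v, v' ∈ C2`, `u` not adjacent to `u'` and `v` not adjacent to
`v'` in `G`. Then assigning `α` to `e`, `β` to `f` and `α + β` to all other matching
edges is a non-conflicting nowhere-zero `Z2 × Z2` flow with respect to `M`. -/
theorem stmt_16 {V : Type} [Fintype V] [DecidableEq V] (G : SimpleGraph V)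
    (hcubic : G.IsRegularOfDegree 3)
    (M : G.Subgraph) (hM : M.IsPerfectMatching)
    (u v u' v' : V)
    (h2comp : ∀ w : V,
      (compl2Factor G M).Reachable u w ∨ (compl2Factor G M).Reachable v w)
    (hsep : ¬ (compl2Factor G M).Reachable u v)
    (hodd1 : Odd (Finset.univ.filter (fun w => (compl2Factor G M).Reachable u w)).card)
    (hodd2 : Odd (Finset.univ.filter (fun w => (compl2Factor G M).Reachable v w)).card)
    (he : M.Adj u v) (hf : M.Adj u' v')
    (hu' : (compl2Factor G M).Reachable u u')
    (hv' : (compl2Factor G M).Reachable v v')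
    (hne : s(u, v) ≠ s(u', v'))
    (hnadj1 : ¬ G.Adj u u') (hnadj2 : ¬ G.Adj v v') :
    IsNZFlowWrt G M
      (fun w => if w = u ∨ w = v then flowAlpha
        else if w = u' ∨ w = v' then flowBeta else flowAlpha + flowBeta) ∧
    NonConflicting G M
      (fun w => if w = u ∨ w = v then flowAlpha
        else if w = u' ∨ w = v' then flowBeta else flowAlpha + flowBeta) := by
  have hadj : ∀ {a b : V}, G.Adj a b → ¬ M.Adj a b → (compl2Factor G M).Reachable a b := by
    intro a b h h'
    refine SimpleGraph.Adj.reachable ?_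
    simpa [compl2Factor, SimpleGraph.deleteEdges_adj] using And.intro h h'
  have huniq : ∀ {a b c : V}, M.Adj a b → M.Adj a c → b = c := fun hb hc =>
    hM.1.eq_of_adj_left hb hc
  have huu' : u ≠ u' := by
    rintro rfl
    exact hne (by rw [huniq he hf])
  have hvv' : v ≠ v' := by
    rintro rfl
    exact huu' (huniq he.symm hf.symm)
  have hnuv' : ¬ (compl2Factor G M).Reachable u v' := fun h => hsep (h.trans hv'.symm)
  have hnvu' : ¬ (compl2Factor G M).Reachable v u' := fun h => hsep (hu'.trans h.symm)
  have huv' : u ≠ v' := fun h => hnuv' (h ▸ .refl _)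
  have hvu' : v ≠ u' := fun h => hnvu' (h ▸ .refl _)
  set θ : V → K4 := fun w => if w = u ∨ w = v then flowAlpha
        else if w = u' ∨ w = v' then flowBeta else flowAlpha + flowBeta with hθ
  have θu : θ u = flowAlpha := by simp [hθ]
  have θv : θ v = flowAlpha := by simp [hθ]
  have θu' : θ u' = flowBeta := by simp [hθ, huu'.symm, hvu'.symm]
  have θv' : θ v' = flowBeta := by simp [hθ, huv'.symm, hvv'.symm]
  have θother : ∀ w, w ≠ u → w ≠ v → w ≠ u' → w ≠ v' → θ w = flowAlpha + flowBeta := by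
    intro w h1 h2 h3 h4
    simp [hθ, h1, h2, h3, h4]
  have hcases : ∀ w, (w = u ∨ w = v) ∨ (w = u' ∨ w = v') ∨
      (w ≠ u ∧ w ≠ v ∧ w ≠ u' ∧ w ≠ v') := by
    intro w
    tauto
  refine ⟨⟨?_, ?_, ?_⟩, ?_⟩
  · intro a b hab
    rcases hcases a with (rfl | rfl) | (rfl | rfl) | ⟨h1, h2, h3, h4⟩
    · rw [θu, huniq hab he, θv]
    · rw [θv, huniq hab he.symm, θu]
    · rw [θu', huniq hab hf, θv']
    · rw [θv', huniq hab hf.symm, θu']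
    · rw [θother a h1 h2 h3 h4, θother b]
      · rintro rfl; exact h2 (huniq hab.symm he)
      · rintro rfl; exact h1 (huniq hab.symm he.symm)
      · rintro rfl; exact h4 (huniq hab.symm hf)
      · rintro rfl; exact h3 (huniq hab.symm hf.symm)
  · intro w
    rcases hcases w with (rfl | rfl) | (rfl | rfl) | ⟨h1, h2, h3, h4⟩
    · rw [θu]; decide
    · rw [θv]; decide
    · rw [θu']; decide
    · rw [θv']; decide
    · rw [θother w h1 h2 h3 h4]; decide
  · intro x
    have hclass : ∀ {a : V}, (compl2Factor G M).Reachable a x → ∀ w,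
        (compl2Factor G M).Reachable x w ↔ (compl2Factor G M).Reachable a w :=
      fun h _ => ⟨h.trans, h.symm.trans⟩
    rcases h2comp x with hx | hx
    · refine (Finset.sum_congr (Finset.ext fun w => by simpa using hclass hx w)
        fun _ _ => rfl).trans <| sum_eq_zero_of_odd_card _ hodd1 (a := u) (b := u') (by simp) (by simpa using hu')
        huu' θ θu θu' fun w hw h1 h2 => ?_
      have hw : (compl2Factor G M).Reachable u w := by simpa using hw
      exact θother w h1 (fun h => hsep (h ▸ hw)) h2 (fun h => hnuv' (h ▸ hw))
    · refine (Finset.sum_congr (Finset.ext fun w => by simpa using hclass hx w)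
        fun _ _ => rfl).trans <| sum_eq_zero_of_odd_card _ hodd2 (a := v) (b := v') (by simp) (by simpa using hv')
        hvv' θ θv θv' fun w hw h1 h2 => ?_
      have hw : (compl2Factor G M).Reachable v w := by simpa using hw
      exact θother w (fun h => hsep (h ▸ hw).symm) h1 (fun h => hnvu' (h ▸ hw)) h2
  · rintro ⟨a, b, hab, hnM, ha, hb⟩
    have hαβ : flowAlpha ≠ flowBeta := by decide
    have hα : flowAlpha + flowBeta ≠ flowAlpha := by decide
    have hβ : flowAlpha + flowBeta ≠ flowBeta := by decide
    have ha' : a = u ∨ a = v := by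
      rcases hcases a with h | (rfl | rfl) | ⟨h1, h2, h3, h4⟩
      · exact h
      · exact absurd (ha.symm.trans θu') hαβ
      · exact absurd (ha.symm.trans θv') hαβ
      · exact absurd ((θother a h1 h2 h3 h4).symm.trans ha) hα
    have hb' : b = u' ∨ b = v' := by
      rcases hcases b with (rfl | rfl) | h | ⟨h1, h2, h3, h4⟩
      · exact absurd (θu.symm.trans hb) hαβ
      · exact absurd (θv.symm.trans hb) hαβ
      · exact h
      · exact absurd ((θother b h1 h2 h3 h4).symm.trans hb) hβ
    rcases ha' with rfl | rfl <;> rcases hb' with rfl | rfl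
    · exact hnadj1 hab
    · exact hnuv' (hadj hab hnM)
    · exact hnvu' (hadj hab hnM)
    · exact hnadj2 hab
end

section
/- Let G be a cubic graph and f a nowhere-zero Z2×Z2×Z2 flow of G. Then f, regarded as an edge-coloring of G whose colors are the seven nonzero elements of (Z2)^3, is a proper edge-coloring in which every edge is poor or rich. In particular, every cubic graph admitting a nowhere-zero Z2×Z2×Z2 flow admits a normal 7-edge-coloring. -/
open scoped Classical

/-- The set of colors appearing on the edges incident to `v`. -/
noncomputable def colorsAt {V : Type} [Fintype V] {k : ℕ} (G : SimpleGraph V)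
    (c : Sym2 V → Fin k) (v : V) : Finset (Fin k) :=
  (Finset.univ.filter (fun w => G.Adj v w)).image (fun w => c s(v, w))

/-- A proper edge-coloring: edges sharing a vertex receive different colors. -/
def IsProperEdgeColoring {V : Type} {k : ℕ} (G : SimpleGraph V) (c : Sym2 V → Fin k) : Prop :=
  ∀ ⦃u v w : V⦄, G.Adj u v → G.Adj u w → v ≠ w → c s(u, v) ≠ c s(u, w)

/-- `G` has a normal `k`-edge-coloring: a proper edge-coloring with at most `k` colors
in which every edge `uv` is poor (`|S_c(u) ∪ S_c(v)| = 3`) or rich (`|S_c(u) ∪ S_c(v)| = 5`). -/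
def HasNormalColoring {V : Type} [Fintype V] (G : SimpleGraph V) (k : ℕ) : Prop :=
  ∃ c : Sym2 V → Fin k, IsProperEdgeColoring G c ∧
    ∀ ⦃u v : V⦄, G.Adj u v →
      ((colorsAt G c u ∪ colorsAt G c v).card = 3 ∨ (colorsAt G c u ∪ colorsAt G c v).card = 5)

/-- The group `Z2 × Z2 × Z2`. -/
abbrev K8 : Type := ZMod 2 × ZMod 2 × ZMod 2

/-- A nowhere-zero `Z2 × Z2 × Z2` flow of `G`: a function on edges, nonzero on every
edge of `G`, whose values sum to zero around every vertex. -/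
def IsNZ8Flow {V : Type} [Fintype V] (G : SimpleGraph V) (f : Sym2 V → K8) : Prop :=
  (∀ e ∈ G.edgeSet, f e ≠ 0) ∧
  (∀ v : V, ∑ w ∈ Finset.univ.filter (fun w => G.Adj v w), f s(v, w) = 0)

/-- The set of `f`-values appearing on the edges incident to `v`. -/
noncomputable def colorsAtK8 {V : Type} [Fintype V] (G : SimpleGraph V)
    (f : Sym2 V → K8) (v : V) : Finset K8 :=
  (Finset.univ.filter (fun w => G.Adj v w)).image (fun w => f s(v, w))

/-- In a cubic graph with a nowhere-zero `Z2 × Z2 × Z2` flow, the three flow values around a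
vertex `u` are `x`, `y` and `x + y`, where `x` and `y` are the values on any two edges at `u`. -/
theorem IsNZ8Flow.add_and_colorsAtK8_eq {V : Type} [Fintype V] {G : SimpleGraph V}
    (hcubic : G.IsRegularOfDegree 3) {f : Sym2 V → K8} (hf : IsNZ8Flow G f) {u v w : V}
    (hv : G.Adj u v) (hw : G.Adj u w) (hvw : v ≠ w) :
    f s(u, v) + f s(u, w) ≠ 0 ∧
      colorsAtK8 G f u = {f s(u, v), f s(u, w), f s(u, v) + f s(u, w)} := by
  have hcard : (Finset.univ.filter (fun a => G.Adj u a)).card = 3 := by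
    rw [← hcubic u, ← SimpleGraph.card_neighborFinset_eq_degree,
      SimpleGraph.neighborFinset_eq_filter]
  have hsub : ({v, w} : Finset V) ⊆ Finset.univ.filter (fun a => G.Adj u a) := by
    simp [Finset.insert_subset_iff, hv, hw]
  obtain ⟨t, ht⟩ := Finset.card_eq_one.mp (show
      (Finset.univ.filter (fun a => G.Adj u a) \ {v, w}).card = 1 by
    rw [Finset.card_sdiff_of_subset hsub, hcard, Finset.card_pair hvw])
  have htmem : G.Adj u t ∧ ¬ (t = v ∨ t = w) := by
    simpa using ht.symm.subset (Finset.mem_singleton_self t)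
  have hset : Finset.univ.filter (fun a => G.Adj u a) = {v, w, t} := by
    rw [← Finset.union_sdiff_of_subset hsub, ht]
    ext a
    simp
  have hsum := hf.2 u
  rw [hset, Finset.sum_insert (by grind), Finset.sum_pair (by grind), ← add_assoc] at hsum
  have hft : f s(u, t) = f s(u, v) + f s(u, w) := by
    have key : ∀ p q : K8, p + q = 0 → q = p := by decide
    exact key _ _ hsum
  refine ⟨hft ▸ hf.1 _ (G.mem_edgeSet.mpr htmem.1), ?_⟩
  rw [colorsAtK8, hset, Finset.image_insert, Finset.image_insert, Finset.image_singleton, hft]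

set_option synthInstance.maxSize 1024 in
/-- Two lines of the Fano plane through the point `x` cover three or five points. -/
theorem K8.card_union_lines : ∀ x y z : K8, x ≠ 0 → y ≠ 0 → z ≠ 0 → x + y ≠ 0 → x + z ≠ 0 →
    (({x, y, x + y} ∪ {x, z, x + z} : Finset K8).card = 3 ∨
      ({x, y, x + y} ∪ {x, z, x + z} : Finset K8).card = 5) := by
  decide

/-- Every vertex of a cubic graph has a neighbour other than a given vertex. -/
theorem SimpleGraph.IsRegularOfDegree.exists_adj_ne {V : Type} [Fintype V] {G : SimpleGraph V}
    (hcubic : G.IsRegularOfDegree 3) (u v : V) : ∃ w, G.Adj u w ∧ v ≠ w := by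
  have hlt : 1 < (G.neighborFinset u).card := by
    rw [SimpleGraph.card_neighborFinset_eq_degree, hcubic u]
    norm_num
  obtain ⟨w, hw, hne⟩ := Finset.exists_mem_ne hlt v
  exact ⟨w, (G.mem_neighborFinset u w).mp hw, hne.symm⟩

/-- There is a map from `K8` to seven colors which is injective on the nonzero elements. -/
theorem K8.exists_injOn_fin_seven : ∃ e : K8 → Fin 7, Set.InjOn e {x | x ≠ 0} := by
  have hcard : Fintype.card {x : K8 // x ≠ 0} = Fintype.card (Fin 7) := by decide
  let e := Fintype.equivOfCardEq hcard
  refine ⟨fun x => if h : x ≠ 0 then e ⟨x, h⟩ else 0, fun x hx y hy hxy => ?_⟩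
  rw [Set.mem_ofPred_eq] at hx hy
  simpa [hx, hy] using hxy

/-- A nowhere-zero `Z2 × Z2 × Z2` flow of a cubic graph, regarded as an edge-coloring
with the seven nonzero elements of `(Z2)^3` as colors, is a proper edge-coloring in which
every edge is poor or rich; in particular such a graph admits a normal 7-edge-coloring. -/
theorem stmt_17 {V : Type} [Fintype V] [DecidableEq V] (G : SimpleGraph V)
    (hcubic : G.IsRegularOfDegree 3)
    (f : Sym2 V → K8) (hf : IsNZ8Flow G f) :
    (∀ ⦃u v w : V⦄, G.Adj u v → G.Adj u w → v ≠ w → f s(u, v) ≠ f s(u, w)) ∧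
    (∀ ⦃u v : V⦄, G.Adj u v →
      ((colorsAtK8 G f u ∪ colorsAtK8 G f v).card = 3 ∨
        (colorsAtK8 G f u ∪ colorsAtK8 G f v).card = 5)) ∧
    HasNormalColoring G 7 := by
  have hproper : ∀ ⦃u v w : V⦄, G.Adj u v → G.Adj u w → v ≠ w → f s(u, v) ≠ f s(u, w) := by
    intro u v w hv hw hvw heq
    have hself : ∀ x : K8, x + x = 0 := by decide
    exact (hf.add_and_colorsAtK8_eq hcubic hv hw hvw).1 (heq ▸ hself _)
  have hnormal : ∀ ⦃u v : V⦄, G.Adj u v →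
      ((colorsAtK8 G f u ∪ colorsAtK8 G f v).card = 3 ∨
        (colorsAtK8 G f u ∪ colorsAtK8 G f v).card = 5) := by
    intro u v huv
    obtain ⟨a, ha, hva⟩ := hcubic.exists_adj_ne u v
    obtain ⟨b, hb, hub⟩ := hcubic.exists_adj_ne v u
    obtain ⟨hu0, hu⟩ := hf.add_and_colorsAtK8_eq hcubic huv ha hva
    obtain ⟨hv0, hv⟩ := hf.add_and_colorsAtK8_eq hcubic huv.symm hb hub
    rw [Sym2.eq_swap (a := v) (b := u)] at hv0 hv
    rw [hu, hv]
    exact K8.card_union_lines _ _ _ (hf.1 _ huv) (hf.1 _ ha) (hf.1 _ hb) hu0 hv0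
  refine ⟨hproper, hnormal, ?_⟩
  obtain ⟨e, he⟩ := K8.exists_injOn_fin_seven
  refine ⟨e ∘ f, fun u v w hv hw hvw heq =>
    hproper hv hw hvw (he (hf.1 _ hv) (hf.1 _ hw) heq), fun u v huv => ?_⟩
  have himage : ∀ w, colorsAt G (e ∘ f) w = (colorsAtK8 G f w).image e := by
    intro w
    rw [colorsAt, colorsAtK8, Finset.image_image]
    rfl
  have hnonzero : ∀ w, ∀ x ∈ colorsAtK8 G f w, x ≠ 0 := by
    intro w x hx
    simp only [colorsAtK8, Finset.mem_image, Finset.mem_filter_univ] at hx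
    obtain ⟨t, ht, rfl⟩ := hx
    exact hf.1 _ ht
  rw [himage, himage, ← Finset.image_union, Finset.card_image_of_injOn]
  · exact hnormal huv
  · refine he.mono fun x hx => ?_
    rcases Finset.mem_union.mp hx with hx | hx <;> exact hnonzero _ x hx
end

section
/- Let G be a cubic graph, M a perfect matching of G, and θ a nowhere-zero Z2×Z2 flow with respect to M. Then G admits a nowhere-zero Z2×Z2×Z2 flow μ, with values in Z2 × (Z2×Z2), such that μ(h) = (0, θ(h)) for every edge h ∈ M and the first coordinate of μ(h) equals 1 for every edge h ∈ E(G) ∖ M. -/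
open scoped Classical

/-- Along a walk from `u` to `w`, a constant edge weight `a` with `a + a = 0` has boundary `a`
at `u` and at `w`, and `0` elsewhere. -/
theorem SimpleGraph.Walk.exists_edge_weight_boundary {V A : Type*} [Fintype V] [AddCommGroup A]
    {H : SimpleGraph V} {u w : V} (p : H.Walk u w) (a : A) (ha : a + a = 0) :
    ∃ f : Sym2 V → A, ∀ x, ∑ y with H.Adj x y, f s(x, y) =
      (if x = u then a else 0) + (if x = w then a else 0) := by
  induction p with
  | nil => exact ⟨0, fun x => by split_ifs <;> simp [ha]⟩
  | @cons u v w h p ih =>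
    obtain ⟨f, hf⟩ := ih
    refine ⟨fun e => f e + if e = s(u, v) then a else 0, fun x => ?_⟩
    have hstep : ∑ y with H.Adj x y, (if s(x, y) = s(u, v) then a else 0) =
        (if x = u then a else 0) + (if x = v then a else 0) := by
      by_cases hxu : x = u
      · subst hxu
        simp [Finset.sum_ite_eq', h.ne, h]
      · by_cases hxv : x = v
        · subst hxv
          have key : ∀ y, (s(x, y) = s(u, x)) ↔ y = u := by
            intro y
            rw [Sym2.eq_swap, Sym2.congr_left]
          simp [key, hxu, h.symm]
        · simp [hxu, hxv]
    rw [Finset.sum_add_distrib, hf, hstep]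
    have hv : (if x = v then a else 0) + (if x = v then a else 0) = 0 := by
      split_ifs <;> simp [ha]
    calc _ = (if x = u then a else 0) + (if x = w then a else 0) +
          ((if x = v then a else 0) + (if x = v then a else 0)) := by abel
      _ = _ := by rw [hv, add_zero]

/-- In a group of exponent two, a vertex weight with zero sum on every connected component is
the boundary of an edge weight. -/
theorem SimpleGraph.exists_edge_weight_boundary_eq {V A : Type*} [Fintype V] [AddCommGroup A]
    (H : SimpleGraph V) (hA : ∀ a : A, a + a = 0) (θ : V → A)
    (hθ : ∀ u, ∑ v with H.Reachable u v, θ v = 0) :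
    ∃ f : Sym2 V → A, ∀ x, ∑ y with H.Adj x y, f s(x, y) = θ x := by
  let r : V → V := fun v => (H.connectedComponentMk v).out
  have hr : ∀ v, H.Reachable v (r v) := fun v =>
    (SimpleGraph.ConnectedComponent.exact (Quot.out_eq (H.connectedComponentMk v))).symm
  have hrr : ∀ {u v}, H.Reachable u v → r u = r v := fun h => by
    simp only [r, SimpleGraph.ConnectedComponent.sound h]
  choose f hf using fun v => (hr v).some.exists_edge_weight_boundary (θ v) (hA _)
  refine ⟨fun e => ∑ v, f v e, fun x => ?_⟩
  rw [Finset.sum_comm]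
  simp only [hf, Finset.sum_add_distrib, Finset.sum_ite_eq, Finset.mem_univ, if_true]
  rw [add_eq_left, ← Finset.sum_filter]
  by_cases hx : r x = x
  · rw [← hθ x]
    refine Finset.sum_congr (Finset.filter_congr fun v _ => ⟨fun h => ?_, fun h => ?_⟩)
      fun _ _ => rfl
    · exact h ▸ (hr v).symm
    · rw [← hrr h, hx]
  · rw [Finset.filter_false_of_mem, Finset.sum_empty]
    rintro v - rfl
    exact hx (hrr (hr v)).symm

/-- If `θ` is a nowhere-zero `Z2 × Z2` flow with respect to a perfect matching `M` of a
cubic graph `G`, then `G` admits a nowhere-zero `Z2 × (Z2 × Z2)` flow `μ` with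
`μ(h) = (0, θ(h))` for every `h ∈ M` and first coordinate `1` on every edge of
`E(G) \ M`. -/
theorem stmt_18 {V : Type} [Fintype V] [DecidableEq V] (G : SimpleGraph V)
    (hcubic : G.IsRegularOfDegree 3)
    (M : G.Subgraph) (hM : M.IsPerfectMatching)
    (θ : V → K4) (hflow : IsNZFlowWrt G M θ) :
    ∃ μ : Sym2 V → ZMod 2 × K4,
      (∀ e ∈ G.edgeSet, μ e ≠ 0) ∧
      (∀ v : V, ∑ w ∈ Finset.univ.filter (fun w => G.Adj v w), μ s(v, w) = 0) ∧
      (∀ ⦃a b : V⦄, M.Adj a b → μ s(a, b) = (0, θ a)) ∧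
      (∀ ⦃a b : V⦄, G.Adj a b → ¬ M.Adj a b → (μ s(a, b)).1 = 1) := by
  classical
  obtain ⟨hθM, hθ0, hθsum⟩ := hflow
  have hK : ∀ a : K4, a + a = 0 := by decide
  obtain ⟨f, hf⟩ := (compl2Factor G M).exists_edge_weight_boundary_eq hK θ
    fun u => by convert hθsum u
  have hM_val : ∀ {a b : V}, M.Adj a b → θ (Quot.out s(a, b)).1 = θ a := by
    intro a b h
    rcases Sym2.mem_iff.1 (Sym2.out_fst_mem s(a, b)) with h' | h'
    · rw [h']
    · rw [h', hθM h]
  have hadj : ∀ a b, (compl2Factor G M).Adj a b ↔ G.Adj a b ∧ ¬ M.Adj a b := by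
    simp [compl2Factor]
  refine ⟨fun e => if e ∈ M.edgeSet then (0, θ (Quot.out e).1) else (1, f e), ?_, ?_, ?_, ?_⟩
  · intro e _
    dsimp only
    split_ifs <;> simp [hθ0]
  · intro v
    obtain ⟨m, hm, hmu⟩ := SimpleGraph.Subgraph.isPerfectMatching_iff.1 hM v
    have hMfilter : (Finset.univ.filter fun w => G.Adj v w ∧ M.Adj v w) = {m} := by
      ext w
      simp only [Finset.mem_filter, Finset.mem_univ, true_and, Finset.mem_singleton]
      exact ⟨fun h => hmu w h.2, fun h => h ▸ ⟨hm.adj_sub, hm⟩⟩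
    have hcard : (Finset.univ.filter fun w => G.Adj v w ∧ ¬ M.Adj v w).card = 2 := by
      have h3 : (Finset.univ.filter fun w => G.Adj v w).card = 3 := by
        rw [← hcubic v, ← SimpleGraph.card_neighborFinset_eq_degree]
        congr 1
        ext w
        simp
      have hsplit := Finset.card_filter_add_card_filter_not
        (s := Finset.univ.filter fun w => G.Adj v w) (fun w => M.Adj v w)
      rw [Finset.filter_filter, Finset.filter_filter, hMfilter, h3] at hsplit
      simp only [Finset.card_singleton] at hsplit
      omega
    have hfv : ∑ w with G.Adj v w ∧ ¬ M.Adj v w, f s(v, w) = θ v := by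
      rw [← hf v]
      simp only [hadj]
    simp only [SimpleGraph.Subgraph.mem_edgeSet]
    rw [Finset.sum_ite, Finset.filter_filter, Finset.filter_filter, hMfilter,
      Finset.sum_singleton, hM_val hm]
    refine Prod.ext ?_ ?_
    · simp only [Prod.fst_add, Prod.fst_sum, Finset.sum_const, hcard]
      decide
    · simp only [Prod.snd_add, Prod.snd_sum, hfv, hK, Prod.snd_zero]
  · intro a b h
    simp [h, hM_val h]
  · intro a b _ h
    simp [h]
end
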